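/- For all integers r ≥ 1 and h with 1 ≤ h ≤ r + 1, and every n ≥ 1, the pair (exc_r, den_h) is equidistributed with (rdes, rmaj) over S_n; that is, for all integers a, b, the number of σ ∈ S_n with exc_r(σ) = a and den_h(σ) = b equals the number of σ ∈ S_n with rdes(σ) = a and rmaj(σ) = b. (Corollary 1.5: (exc_r, den_h) is r-Euler–Mahonian for all 1 ≤ h ≤ r+1.) -/

import Mathlib

open Finset

namespace PaperStmt

/-- 1-based position of `i : Fin n` (so positions run through `1,…,n`). -/
def pos1 {n : ℕ} (i : Fin n) : ℕ := (i : ℕ) + 1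

/-- 1-based value `σ_i` of the permutation `σ` at position `i`. -/
def val1 {n : ℕ} (σ : Equiv.Perm (Fin n)) (i : Fin n) : ℕ := (σ i : ℕ) + 1

/-- The number of inversions of the subsequence of `σ` consisting of the letters at the
positions satisfying `P`: pairs of positions `i < j`, both satisfying `P`,
with `σ_i > σ_j`. -/
def invOn {n : ℕ} (σ : Equiv.Perm (Fin n)) (P : Fin n → Prop) [DecidablePred P] : ℕ :=
  (univ.filter fun p : Fin n × Fin n =>
    p.1 < p.2 ∧ P p.1 ∧ P p.2 ∧ val1 σ p.2 < val1 σ p.1).card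

/-- `inv σ`: the number of inversions of `σ`. -/
def inv {n : ℕ} (σ : Equiv.Perm (Fin n)) : ℕ := invOn σ (fun _ => True)

/-- `Exc(σ)`: the set of excedances, i.e. positions `i` with `σ_i > i`. -/
def excSet {n : ℕ} (σ : Equiv.Perm (Fin n)) : Finset (Fin n) :=
  univ.filter fun i => pos1 i < val1 σ i

/-- `exc σ`: the number of excedances. -/
def exc {n : ℕ} (σ : Equiv.Perm (Fin n)) : ℕ := (excSet σ).card

/-- `exc_r(σ)`: the number of `r`-level excedances, i.e. positions `i ≥ r` with `σ_i > i`. -/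
def excLvl {n : ℕ} (r : ℕ) (σ : Equiv.Perm (Fin n)) : ℕ :=
  (univ.filter fun i => pos1 i < val1 σ i ∧ r ≤ pos1 i).card

/-- Denert's statistic `den σ`. -/
def den {n : ℕ} (σ : Equiv.Perm (Fin n)) : ℕ :=
  ((univ.filter fun i => pos1 i < val1 σ i).sum pos1)
  + invOn σ (fun i => pos1 i < val1 σ i)
  + invOn σ (fun i => ¬ pos1 i < val1 σ i)

/-- The `h`-level Denert statistic `den_h(σ)`. -/
def denLvl {n : ℕ} (h : ℕ) (σ : Equiv.Perm (Fin n)) : ℕ :=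
  ((univ.filter fun i => pos1 i < val1 σ i ∧ h ≤ val1 σ i).sum pos1)
  + invOn σ (fun i => pos1 i < val1 σ i ∧ h ≤ val1 σ i)
  + invOn σ (fun i => ¬ (pos1 i < val1 σ i ∧ h ≤ val1 σ i))

/-- `g exc_ℓ(σ)`: the number of `g`-gap `ℓ`-level excedances,
i.e. positions `i ≥ ℓ` with `σ_i ≥ i + g`. -/
def gexc {n : ℕ} (g l : ℕ) (σ : Equiv.Perm (Fin n)) : ℕ :=
  (univ.filter fun i => pos1 i + g ≤ val1 σ i ∧ l ≤ pos1 i).card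

/-- `gExclp_h(σ)`: the set of `g`-gap `h`-level excedance-letter positions,
i.e. positions `i` with `σ_i ≥ i + g` and `σ_i ≥ h`. -/
def gExclpSet {n : ℕ} (g h : ℕ) (σ : Equiv.Perm (Fin n)) : Finset (Fin n) :=
  univ.filter fun i => pos1 i + g ≤ val1 σ i ∧ h ≤ val1 σ i

/-- The `g`-gap `h`-level Denert statistic `g den_h(σ)`. -/
def gden {n : ℕ} (g h : ℕ) (σ : Equiv.Perm (Fin n)) : ℕ :=
  ((univ.filter fun i => pos1 i + g ≤ val1 σ i ∧ h ≤ val1 σ i).sum fun i => pos1 i + g - 1)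
  + invOn σ (fun i => pos1 i + g ≤ val1 σ i ∧ h ≤ val1 σ i)
  + invOn σ (fun i => ¬ (pos1 i + g ≤ val1 σ i ∧ h ≤ val1 σ i))

/-- `rexc σ`: the number of `r`-excedances, i.e. positions `i` with `σ_i ≥ i + r`. -/
def rexc {n : ℕ} (r : ℕ) (σ : Equiv.Perm (Fin n)) : ℕ :=
  (univ.filter fun i => pos1 i + r ≤ val1 σ i).card

/-- The `r`-Denert statistic `rden σ`. -/
def rden {n : ℕ} (r : ℕ) (σ : Equiv.Perm (Fin n)) : ℕ :=
  ((univ.filter fun i => pos1 i + r ≤ val1 σ i).sum fun i => pos1 i + r - 1)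
  + invOn σ (fun i => pos1 i + r ≤ val1 σ i)
  + invOn σ (fun i => ¬ pos1 i + r ≤ val1 σ i)

/-- Pairs `(i, i+1)` of adjacent positions forming an `r`-descent: `σ_i ≥ σ_{i+1} + r`. -/
def rdesPairs {n : ℕ} (r : ℕ) (σ : Equiv.Perm (Fin n)) : Finset (Fin n × Fin n) :=
  univ.filter fun p => pos1 p.2 = pos1 p.1 + 1 ∧ val1 σ p.2 + r ≤ val1 σ p.1

/-- `rdes σ`: the number of `r`-descents. -/
def rdes {n : ℕ} (r : ℕ) (σ : Equiv.Perm (Fin n)) : ℕ := (rdesPairs r σ).card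

/-- `rmaj σ`: the sum of the `r`-descents plus the number of pairs `i < j`
with `σ_j < σ_i < σ_j + r`. -/
def rmaj {n : ℕ} (r : ℕ) (σ : Equiv.Perm (Fin n)) : ℕ :=
  ((rdesPairs r σ).sum fun p => pos1 p.1)
  + (univ.filter fun p : Fin n × Fin n =>
      p.1 < p.2 ∧ val1 σ p.2 < val1 σ p.1 ∧ val1 σ p.1 < val1 σ p.2 + r).card

/-- `des σ`: the number of descents, i.e. positions `i ∈ [n-1]` with `σ_i > σ_{i+1}`. -/
def des {n : ℕ} (σ : Equiv.Perm (Fin n)) : ℕ :=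
  (univ.filter fun p : Fin n × Fin n =>
    pos1 p.2 = pos1 p.1 + 1 ∧ val1 σ p.2 < val1 σ p.1).card

/-- `maj σ`: the major index, i.e. the sum of the descents of `σ`. -/
def maj {n : ℕ} (σ : Equiv.Perm (Fin n)) : ℕ :=
  ((univ.filter fun p : Fin n × Fin n =>
    pos1 p.2 = pos1 p.1 + 1 ∧ val1 σ p.2 < val1 σ p.1).sum fun p => pos1 p.1)

/-- The `q`-bracket `(q ^ a - 1) / (q - 1)` of an integer. -/
noncomputable def qBracket (q : ℝ) (a : ℤ) : ℝ := (q ^ a - 1) / (q - 1)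

/-- The `q`-binomial coefficient `[y + N choose N]`, with value `0` for negative `y`. -/
noncomputable def qMultichoose (q : ℝ) (N : ℕ) (y : ℤ) : ℝ :=
  if y < 0 then 0 else ∏ i ∈ range N, qBracket q (y + i + 1) / qBracket q (i + 1)

section QAnalogues

variable {q : ℝ}

lemma qBracket_zero : qBracket q 0 = 0 := by simp [qBracket]

lemma qBracket_succ (hq : 1 < q) (a : ℤ) : qBracket q (a + 1) = q * qBracket q a + 1 := by
  have h1 : q - 1 ≠ 0 := by linarith
  rw [qBracket, qBracket, zpow_add₀ (by linarith)]
  field_simp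
  ring

lemma qBracket_succ' (hq : 1 < q) (a : ℤ) : qBracket q (a + 1) = qBracket q a + q ^ a := by
  have h1 : q - 1 ≠ 0 := by linarith
  rw [qBracket, qBracket, zpow_add₀ (by linarith)]
  field_simp
  ring

lemma qBracket_natCast_succ_ne_zero (hq : 1 < q) (n : ℕ) : qBracket q (n + 1) ≠ 0 := by
  have h := one_lt_pow₀ hq n.succ_ne_zero
  have h2 : q ^ ((n : ℤ) + 1) = q ^ (n + 1) := by exact_mod_cast zpow_natCast q (n + 1)
  rw [qBracket, h2]
  exact div_ne_zero (by rw [Nat.succ_eq_add_one] at h; linarith) (by linarith)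

lemma qBracket_mul_add (hq : 1 < q) (k y M : ℤ) :
    qBracket q k * qBracket q (y + M) + q ^ k * qBracket q (M - k) * qBracket q y
      = qBracket q M * qBracket q (y + k) := by
  have h0 : q ≠ 0 := by linarith
  have h1 : q - 1 ≠ 0 := by linarith
  have h2 : q ^ k ≠ 0 := zpow_ne_zero _ h0
  simp only [qBracket, zpow_add₀ h0, zpow_sub₀ h0]
  field_simp
  ring

lemma qMultichoose_of_neg {N : ℕ} {y : ℤ} (hy : y < 0) : qMultichoose q N y = 0 := if_pos hy

lemma qMultichoose_zero_right (hq : 1 < q) (N : ℕ) : qMultichoose q N 0 = 1 := by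
  rw [qMultichoose, if_neg (lt_irrefl _)]
  refine prod_eq_one fun i _ => ?_
  rw [zero_add, div_self (qBracket_natCast_succ_ne_zero hq i)]

lemma qBracket_mul_qMultichoose_succ (hq : 1 < q) (N : ℕ) (y : ℤ) :
    qBracket q (N + 1) * qMultichoose q (N + 1) y
      = qBracket q (y + (N + 1)) * qMultichoose q N y := by
  have h := qBracket_natCast_succ_ne_zero hq N
  unfold qMultichoose
  split_ifs
  · simp
  · rw [prod_range_succ, add_assoc y]
    field_simp

lemma qBracket_mul_qMultichoose_succ_pred (hq : 1 < q) (N : ℕ) (y : ℤ) :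
    qBracket q (N + 1) * qMultichoose q (N + 1) (y - 1)
      = qBracket q y * qMultichoose q N y := by
  have h := qBracket_natCast_succ_ne_zero hq N
  rcases lt_trichotomy y 0 with hy | rfl | hy
  · rw [qMultichoose_of_neg hy, qMultichoose_of_neg (by lia)]; simp
  · rw [qMultichoose_of_neg (by lia), qBracket_zero]; simp
  · rw [qMultichoose, qMultichoose, if_neg (by lia), if_neg (by lia), prod_div_distrib,
      prod_div_distrib, prod_range_succ', prod_range_succ (fun i : ℕ => qBracket q (i + 1))]
    have h1 : ∀ i : ℕ, y - 1 + ((i + 1 : ℕ) : ℤ) + 1 = y + i + 1 := fun i => by push_cast; ring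
    have h2 : y - 1 + ((0 : ℕ) : ℤ) + 1 = y := by push_cast; ring
    simp only [h1, h2]
    field_simp

lemma qBracket_mul_qMultichoose_add (hq : 1 < q) (N : ℕ) (k y : ℤ) :
    qBracket q k * qMultichoose q (N + 1) y
      + q ^ k * qBracket q (N + 1 - k) * qMultichoose q (N + 1) (y - 1)
      = qBracket q (y + k) * qMultichoose q N y := by
  apply mul_left_cancel₀ (qBracket_natCast_succ_ne_zero hq N)
  linear_combination qBracket q k * qBracket_mul_qMultichoose_succ hq N y
    + q ^ k * qBracket q (N + 1 - k) * qBracket_mul_qMultichoose_succ_pred hq N y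
    + qMultichoose q N y * qBracket_mul_add hq k y (N + 1)

lemma qMultichoose_succ_sub (hq : 1 < q) (N : ℕ) (y : ℤ) :
    qMultichoose q (N + 1) y - q ^ (N + 1) * qMultichoose q (N + 1) (y - 1)
      = qMultichoose q N y := by
  have h := qBracket_natCast_succ_ne_zero hq N
  have h1 : q - 1 ≠ 0 := by linarith
  have e1 := qBracket_mul_qMultichoose_succ hq N y
  have e2 := qBracket_mul_qMultichoose_succ_pred hq N y
  have e3 : qBracket q (y + (N + 1)) - q ^ (N + 1) * qBracket q y = qBracket q (N + 1) := by
    have : q ^ ((N : ℤ) + 1) = q ^ (N + 1) := by exact_mod_cast zpow_natCast q (N + 1)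
    rw [qBracket, qBracket, qBracket, zpow_add₀ (by linarith : q ≠ 0) y, this]
    field_simp
    ring
  apply mul_left_cancel₀ h
  linear_combination e1 - q ^ (N + 1) * e2 + qMultichoose q N y * e3

/-- A telescoping sum for the difference of two products whose factors satisfy `u = q * l + 1`. -/
lemma sum_pow_mul_prod_mul_prod {u l : ℕ → ℝ} (h : ∀ i, u i = q * l i + 1) (n : ℕ) :
    ∑ j ∈ range n, q ^ (n - 1 - j) * ((∏ i ∈ range j, u i) * ∏ i ∈ Ico (j + 1) n, l i)
      = ∏ i ∈ range n, u i - q ^ n * ∏ i ∈ range n, l i := by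
  induction n with
  | zero => simp
  | succ n ih =>
    rw [sum_range_succ, prod_range_succ, prod_range_succ]
    have h1 : ∑ j ∈ range n, q ^ (n + 1 - 1 - j) *
        ((∏ i ∈ range j, u i) * ∏ i ∈ Ico (j + 1) (n + 1), l i)
        = q * l n * ∑ j ∈ range n, q ^ (n - 1 - j) *
          ((∏ i ∈ range j, u i) * ∏ i ∈ Ico (j + 1) n, l i) := by
      rw [mul_sum]
      refine sum_congr rfl fun j hj => ?_
      have hj := mem_range.1 hj
      rw [prod_Ico_succ_top (by lia), show n + 1 - 1 - j = n - 1 - j + 1 by lia, pow_succ]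
      ring
    rw [h1, ih, h n]
    simp
    ring

/-- The distribution of the insertion labels: when the places `p < n` satisfying `S` (and the last
place `p = n`) get their rank from the right, and the others a label continuing the count. -/
lemma sum_insertion_labels (hq : 1 < q) (S : ℕ → Prop) [DecidablePred S] (f : ℕ → ℝ) (n : ℕ) :
    ∑ p ∈ range (n + 1), q ^ ((∑ k ∈ range n, if p ≤ k ∧ S k then 1 else 0)
        + if p < n ∧ ¬ S p then p + 1 else 0) * f (if p < n ∧ ¬ S p then 1 else 0)
      = qBracket q ((∑ k ∈ range n, if S k then 1 else 0 : ℕ) + 1) * f 0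
        + q ^ ((∑ k ∈ range n, if S k then 1 else 0) + 1)
          * qBracket q (n - (∑ k ∈ range n, if S k then 1 else 0 : ℕ)) * f 1 := by
  induction n with
  | zero => simp [qBracket, div_self (show q - 1 ≠ 0 by linarith)]
  | succ n ih =>
    rw [sum_range_succ] at ih
    rw [sum_range_succ, sum_range_succ]
    have z : ∀ m : ℕ, n ≤ m → (∑ k ∈ range n, if m ≤ k ∧ S k then 1 else 0) = 0 := fun m hm =>
      sum_eq_zero fun k hk => if_neg fun h => by have := mem_range.1 hk; lia
    have hlt : ∀ p ∈ range n, (p < n + 1 ∧ ¬ S p ↔ p < n ∧ ¬ S p) := fun p hp => by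
      have := mem_range.1 hp; lia
    have hpow : ∀ m : ℕ, q ^ ((m : ℤ) + 1) = q ^ (m + 1) := fun m => by
      exact_mod_cast zpow_natCast q (m + 1)
    obtain ⟨s, hs⟩ : ∃ s, (∑ k ∈ range n, if S k then 1 else 0) = s := ⟨_, rfl⟩
    have hz := z n le_rfl
    by_cases hS : S n
    · have h1 : ∑ p ∈ range n, q ^ ((∑ k ∈ range (n + 1), if p ≤ k ∧ S k then 1 else 0)
          + if p < n + 1 ∧ ¬ S p then p + 1 else 0) * f (if p < n + 1 ∧ ¬ S p then 1 else 0)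
          = q * ∑ p ∈ range n, q ^ ((∑ k ∈ range n, if p ≤ k ∧ S k then 1 else 0)
          + if p < n ∧ ¬ S p then p + 1 else 0) * f (if p < n ∧ ¬ S p then 1 else 0) := by
        rw [mul_sum]
        refine sum_congr rfl fun p hp => ?_
        simp only [hlt p hp]
        rw [sum_range_succ, if_pos ⟨(mem_range.1 hp).le, hS⟩]
        ring
      rw [h1]
      simp only [sum_range_succ, hz, z (n + 1) (by lia), hS, hs] at ih ⊢
      simp at ih ⊢
      rw [qBracket_succ hq (s + 1)]
      rw [pow_succ q (s + 1)]
      linear_combination q * ih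
    · have h1 : ∑ p ∈ range n, q ^ ((∑ k ∈ range (n + 1), if p ≤ k ∧ S k then 1 else 0)
          + if p < n + 1 ∧ ¬ S p then p + 1 else 0) * f (if p < n + 1 ∧ ¬ S p then 1 else 0)
          = ∑ p ∈ range n, q ^ ((∑ k ∈ range n, if p ≤ k ∧ S k then 1 else 0)
          + if p < n ∧ ¬ S p then p + 1 else 0) * f (if p < n ∧ ¬ S p then 1 else 0) := by
        refine sum_congr rfl fun p hp => ?_
        simp only [hlt p hp]
        rw [sum_range_succ, if_neg (by tauto), add_zero]
      rw [h1]
      simp only [sum_range_succ, hz, z (n + 1) (by lia), hS, hs] at ih ⊢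
      simp at ih ⊢
      have e : q ^ (n + 1) = q ^ (s + 1) * q ^ ((n : ℤ) - s) := by
        rw [← hpow, ← hpow, ← zpow_add₀ (by linarith)]
        congr 1
        ring
      rw [show (n : ℤ) + 1 - s = n - s + 1 by ring, qBracket_succ' hq (n - s), e]
      linear_combination ih

end QAnalogues

/-- The permutation obtained from `σ` by inserting the letter `v` at position `p`. -/
def insertPerm {n : ℕ} (p v : Fin (n + 1)) (σ : Equiv.Perm (Fin n)) : Equiv.Perm (Fin (n + 1)) :=
  (finSuccEquiv' p).trans ((Equiv.optionCongr σ).trans (finSuccEquiv' v).symm)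

section InsertPerm

variable {n : ℕ} (p v : Fin (n + 1)) (σ : Equiv.Perm (Fin n))

@[simp]
lemma insertPerm_self : insertPerm p v σ p = v := by simp [insertPerm]

@[simp]
lemma insertPerm_succAbove (i : Fin n) :
    insertPerm p v σ (p.succAbove i) = v.succAbove (σ i) := by simp [insertPerm]

lemma insertPerm_bijective_position :
    Function.Bijective fun x : Fin (n + 1) × Equiv.Perm (Fin n) => insertPerm x.1 v x.2 := by
  rw [Fintype.bijective_iff_injective_and_card]
  refine ⟨?_, by simp [Fintype.card_perm, Nat.factorial_succ]⟩
  rintro ⟨p, σ⟩ ⟨p', σ'⟩ h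
  dsimp only at h
  obtain rfl : p = p' := by
    apply (insertPerm p v σ).injective
    rw [insertPerm_self, h, insertPerm_self]
  congr 1
  ext i : 1
  have := DFunLike.congr_fun h (p.succAbove i)
  simpa using this

lemma insertPerm_bijective_letter :
    Function.Bijective fun x : Fin (n + 1) × Equiv.Perm (Fin n) => insertPerm p x.1 x.2 := by
  rw [Fintype.bijective_iff_injective_and_card]
  refine ⟨?_, by simp [Fintype.card_perm, Nat.factorial_succ]⟩
  rintro ⟨v, σ⟩ ⟨v', σ'⟩ h
  dsimp only at h
  obtain rfl : v = v' := by
    have := DFunLike.congr_fun h p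
    simpa using this
  congr 1
  ext i : 1
  have := DFunLike.congr_fun h (p.succAbove i)
  simpa using this

lemma sum_perm_eq_sum_insertPerm_position (f : Equiv.Perm (Fin (n + 1)) → ℝ) :
    ∑ τ, f τ = ∑ σ, ∑ p, f (insertPerm p v σ) := by
  rw [← (insertPerm_bijective_position v).sum_comp f, Fintype.sum_prod_type, sum_comm]

lemma sum_perm_eq_sum_insertPerm_letter (f : Equiv.Perm (Fin (n + 1)) → ℝ) :
    ∑ τ, f τ = ∑ v, ∑ σ, f (insertPerm p v σ) := by
  rw [← (insertPerm_bijective_letter p).sum_comp f, Fintype.sum_prod_type]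

end InsertPerm

lemma val_succAbove {n : ℕ} (p : Fin (n + 1)) (i : Fin n) :
    (p.succAbove i : ℕ) = if (i : ℕ) < p then (i : ℕ) else i + 1 := by
  rw [Fin.succAbove]
  simp only [Fin.lt_def, Fin.val_castSucc]
  split_ifs <;> simp

/-- Whether the letter of `w` in row `i` lies on the Ferrers board whose column `j` consists of the
rows `i < c j`. -/
abbrev IsHit {N : ℕ} (c : ℕ → ℕ) (w : Equiv.Perm (Fin N)) (i : Fin N) : Prop :=
  (i : ℕ) < c (w i)

/-- The Denert-type statistic of a Ferrers board, normalised so that it is Mahonian for every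
board. -/
def boardStat {N : ℕ} (c : ℕ → ℕ) (w : Equiv.Perm (Fin N)) : ℤ :=
  (∑ i : Fin N, if IsHit c w i then (i : ℤ) + w i + 1 - c (w i) else 0)
  + ∑ i : Fin N, ∑ k : Fin N, if i < k ∧ w k < w i ∧ (IsHit c w i ↔ IsHit c w k) then 1 else 0

/-- The number of hits on the Ferrers board `c` in rows `R` and below. -/
def boardHits {N : ℕ} (R : ℕ) (c : ℕ → ℕ) (w : Equiv.Perm (Fin N)) : ℕ :=
  ∑ i : Fin N, if IsHit c w i ∧ R ≤ i then 1 else 0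

/-- The board with column `j` and row `N` removed. -/
def removeColumn (c : ℕ → ℕ) (N j l : ℕ) : ℕ := min (c (if l < j then l else l + 1)) N

lemma removeColumn_le (c : ℕ → ℕ) (N j l : ℕ) : removeColumn c N j l ≤ N := min_le_right _ _

lemma monotone_removeColumn {c : ℕ → ℕ} (hc : Monotone c) (N j : ℕ) :
    Monotone (removeColumn c N j) := fun a b hab =>
  min_le_min_right _ (hc (by split_ifs <;> lia))

section RemoveLastRow

variable {N : ℕ} (c : ℕ → ℕ) (j : Fin (N + 1)) (w : Equiv.Perm (Fin N))

lemma isHit_insertPerm_last_castSucc (i : Fin N) :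
    IsHit c (insertPerm (Fin.last N) j w) i.castSucc ↔ IsHit (removeColumn c N j) w i := by
  rw [IsHit, IsHit, ← Fin.succAbove_last, insertPerm_succAbove, Fin.succAbove_last,
    Fin.val_castSucc, val_succAbove, removeColumn]
  have := i.isLt
  lia

lemma isHit_insertPerm_last_last :
    IsHit c (insertPerm (Fin.last N) j w) (Fin.last N) ↔ N < c j := by
  rw [IsHit, insertPerm_self, Fin.val_last]

lemma boardHits_insertPerm (R : ℕ) :
    boardHits R c (insertPerm (Fin.last N) j w)
      = boardHits R (removeColumn c N j) w + if N < c j ∧ R ≤ N then 1 else 0 := by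
  simp only [boardHits, Fin.sum_univ_castSucc, isHit_insertPerm_last_castSucc,
    isHit_insertPerm_last_last, Fin.val_castSucc, Fin.val_last]

lemma sum_range_ite_le_and_lt {a b n : ℕ} (hab : a ≤ b) (hbn : b ≤ n) :
    ∑ l ∈ range n, (if a ≤ l ∧ l < b then 1 else 0 : ℤ) = b - a := by
  rw [sum_boole, show (range n).filter (fun l => a ≤ l ∧ l < b) = Ico a b by
    ext; simp only [mem_filter, mem_range, mem_Ico]; lia, Nat.card_Ico]
  lia

lemma boardStat_insertPerm {m : ℕ} (hm : ∀ i ≤ N, N < c i ↔ m ≤ i) (hmN : m ≤ N + 1)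
    (hc : ∀ i ≤ N, c i ≤ N + 1) :
    boardStat c (insertPerm (Fin.last N) j w) = boardStat (removeColumn c N j) w
      + ((if (j : ℕ) < m then m - 1 - j else N + m - j : ℕ) : ℤ) := by
  have hj := j.isLt
  let δ : ℕ → ℤ := fun l => if m ≤ j
    then (if (j : ℕ) ≤ l ∧ l < N then 1 else 0) - (if m ≤ l ∧ l < j then 1 else 0)
    else if (j : ℕ) ≤ l ∧ l < m - 1 then 1 else 0
  have hval : ∀ i : Fin N, insertPerm (Fin.last N) j w i.castSucc = j.succAbove (w i) :=
    fun i => by rw [← Fin.succAbove_last, insertPerm_succAbove]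
  have hrow : ∀ i : Fin N,
      (if IsHit c (insertPerm (Fin.last N) j w) i.castSucc
        then ((i.castSucc : Fin (N + 1)) : ℤ) + (insertPerm (Fin.last N) j w i.castSucc : ℕ) + 1
          - c (insertPerm (Fin.last N) j w i.castSucc) else 0)
      + (if i.castSucc < Fin.last N ∧ insertPerm (Fin.last N) j w (Fin.last N)
          < insertPerm (Fin.last N) j w i.castSucc ∧
          (IsHit c (insertPerm (Fin.last N) j w) i.castSucc ↔
            IsHit c (insertPerm (Fin.last N) j w) (Fin.last N)) then 1 else 0)
      = (if IsHit (removeColumn c N j) w i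
        then (i : ℤ) + w i + 1 - removeColumn c N j (w i) else 0) + δ (w i) := by
    intro i
    have hi := i.isLt
    have hwi := (w i).isLt
    have hle : (j.succAbove (w i) : ℕ) ≤ N := Fin.is_le _
    have h1 := hm _ hle
    have h2 := hc _ hle
    have h3 := hm j (by lia)
    simp only [hval, insertPerm_self, IsHit, δ, Fin.lt_def, Fin.val_castSucc, Fin.val_last]
    have h4 : removeColumn c N j (w i) = min (c (j.succAbove (w i))) N := by
      rw [removeColumn, val_succAbove]
    rw [h4]
    have h5 := val_succAbove j (w i)
    generalize c (j.succAbove (w i)) = C at *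
    generalize (j.succAbove (w i) : ℕ) = s at *
    split_ifs at * <;> lia
  have hδ : (if IsHit c (insertPerm (Fin.last N) j w) (Fin.last N)
        then ((Fin.last N : Fin (N + 1)) : ℤ) + (insertPerm (Fin.last N) j w (Fin.last N) : ℕ) + 1
          - c (insertPerm (Fin.last N) j w (Fin.last N)) else 0) + ∑ i, δ (w i)
      = ((if (j : ℕ) < m then m - 1 - j else N + m - j : ℕ) : ℤ) := by
    rw [Equiv.sum_comp w (fun l => δ l), Fin.sum_univ_eq_sum_range δ]
    simp only [isHit_insertPerm_last_last, insertPerm_self, Fin.val_last]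
    have h3 := hm j (by lia)
    have h2 := hc j (by lia)
    by_cases hmj : m ≤ j
    · simp only [δ, if_pos hmj]
      rw [sum_sub_distrib, sum_range_ite_le_and_lt (by lia) le_rfl,
        sum_range_ite_le_and_lt hmj (by lia), if_pos (h3.2 hmj), if_neg (by lia)]
      have := h3.2 hmj
      lia
    · simp only [δ, if_neg hmj]
      rw [sum_range_ite_le_and_lt (by lia) (by lia), if_neg (by tauto), if_pos (by lia)]
      lia
  have hpair : ∀ i k : Fin N,
      (if i.castSucc < k.castSucc ∧ insertPerm (Fin.last N) j w k.castSucc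
          < insertPerm (Fin.last N) j w i.castSucc ∧
          (IsHit c (insertPerm (Fin.last N) j w) i.castSucc ↔
            IsHit c (insertPerm (Fin.last N) j w) k.castSucc) then 1 else 0 : ℤ)
      = if i < k ∧ w k < w i ∧
          (IsHit (removeColumn c N j) w i ↔ IsHit (removeColumn c N j) w k) then 1 else 0 := by
    intro i k
    simp only [isHit_insertPerm_last_castSucc, hval, Fin.castSucc_lt_castSucc_iff,
      Fin.succAbove_lt_succAbove_iff]
  have hlast : ∀ k : Fin (N + 1), ¬ Fin.last N < k := fun k => not_lt.2 k.le_last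
  unfold boardStat
  simp only [Fin.sum_univ_castSucc (n := N), hpair, hlast, false_and, if_false, sum_const_zero,
    add_zero, sum_add_distrib]
  have hsum := Finset.sum_congr (rfl : (univ : Finset (Fin N)) = univ) fun i _ => hrow i
  simp only [sum_add_distrib] at hsum
  linarith

end RemoveLastRow

lemma sum_range_pow_mul_prod {q : ℝ} {u l : ℕ → ℝ} (h : ∀ i, u i = q * l i + 1) {m n : ℕ}
    (hmn : m ≤ n) :
    ∑ j ∈ range m, q ^ (m - 1 - j) * ((∏ i ∈ range j, u i) * ∏ i ∈ Ico (j + 1) n, l i)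
      = (∏ i ∈ range m, u i - q ^ m * ∏ i ∈ range m, l i) * ∏ i ∈ Ico m n, l i := by
  rw [← sum_pow_mul_prod_mul_prod h, sum_mul]
  refine sum_congr rfl fun j hj => ?_
  rw [← prod_Ico_consecutive l (show j + 1 ≤ m by have := mem_range.1 hj; lia) hmn]
  ring

lemma sum_Ico_pow_mul_prod {q : ℝ} {u l : ℕ → ℝ} (h : ∀ i, u i = q * l i + 1) {m n : ℕ}
    (hmn : m ≤ n) :
    ∑ j ∈ Ico m n, q ^ (n - 1 + m - j) * ((∏ i ∈ range j, u i) * ∏ i ∈ Ico (j + 1) n, l i)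
      = q ^ m * (∏ i ∈ range m, u i)
        * (∏ i ∈ Ico m n, u i - q ^ (n - m) * ∏ i ∈ Ico m n, l i) := by
  rw [prod_Ico_eq_prod_range u m n, prod_Ico_eq_prod_range l m n,
    ← sum_pow_mul_prod_mul_prod (fun i => h (m + i)) (n - m), mul_sum, sum_Ico_eq_sum_range]
  refine sum_congr rfl fun j hj => ?_
  have hj := mem_range.1 hj
  rw [show n - 1 + m - (m + j) = m + (n - m - 1 - j) by lia, pow_add, prod_range_add,
    prod_Ico_add l (j + 1) (n - m) m]
  rw [show j + 1 + m = m + j + 1 by ring, show n - m + m = n by lia]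
  ring

lemma prod_removeColumn {N j : ℕ} (hj : j ≤ N) (c : ℕ → ℕ) (F : ℤ → ℕ → ℝ) (y : ℤ) :
    ∏ l ∈ range N, F (y + l) (removeColumn c N j l)
      = (∏ i ∈ range j, F (y + i) (min (c i) N))
        * ∏ i ∈ Ico (j + 1) (N + 1), F (y - 1 + i) (min (c i) N) := by
  rw [← prod_range_mul_prod_Ico _ hj, ← prod_Ico_add' _ j N 1]
  congr 1
  · refine prod_congr rfl fun l hl => ?_
    rw [removeColumn, if_pos (mem_range.1 hl)]
  · refine prod_congr rfl fun l hl => ?_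
    have := (mem_Ico.1 hl).1
    rw [removeColumn, if_neg (by lia)]
    congr 1
    push_cast
    ring

/-- A weakly increasing sequence bounded by `n` at `n` has a fixed point at most `n`. -/
lemma exists_fixed_of_monotone {γ : ℕ → ℕ} (hγ : Monotone γ) {n : ℕ} (hn : γ n ≤ n) :
    ∃ i ≤ n, γ i = i := by
  classical
  have hex : ∃ i, γ i ≤ i := ⟨n, hn⟩
  refine ⟨Nat.find hex, Nat.find_min' hex hn, le_antisymm (Nat.find_spec hex) ?_⟩
  by_contra! hlt
  obtain ⟨i, hi⟩ : ∃ i, Nat.find hex = i + 1 := ⟨Nat.find hex - 1, by lia⟩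
  have h1 := Nat.find_min hex (show i < Nat.find hex by lia)
  have h2 := hγ (show i ≤ Nat.find hex by lia)
  lia

lemma exists_first_full_column {c : ℕ → ℕ} (hc : Monotone c) (N : ℕ) :
    ∃ m ≤ N + 1, ∀ i ≤ N, N < c i ↔ m ≤ i := by
  classical
  have hex : ∃ i, N < c i ∨ N + 1 ≤ i := ⟨N + 1, Or.inr le_rfl⟩
  refine ⟨Nat.find hex, Nat.find_min' hex (Or.inr le_rfl), fun i hi =>
    ⟨fun h => Nat.find_min' hex (Or.inl h), fun h => ?_⟩⟩
  rcases Nat.find_spec hex with h1 | h1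
  · exact h1.trans_le (hc h)
  · lia

section BoardSum

variable {q : ℝ} (R : ℕ)

/-- The generating function of `boardStat` and `boardHits`, in the basis of `q`-binomial
coefficients with upper argument `x`. -/
noncomputable def boardSum (q : ℝ) (R N : ℕ) (c : ℕ → ℕ) (M : ℕ) (x : ℤ) : ℝ :=
  ∑ w : Equiv.Perm (Fin N), q ^ boardStat c w * qMultichoose q M (x - boardHits R c w)

lemma boardSum_of_neg (N : ℕ) (c : ℕ → ℕ) (M : ℕ) {x : ℤ} (hx : x < 0) :
    boardSum q R N c M x = 0 :=
  sum_eq_zero fun w _ => by rw [qMultichoose_of_neg (by lia), mul_zero]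

lemma boardSum_succ_sub (hq : 1 < q) (N : ℕ) (c : ℕ → ℕ) (M : ℕ) (x : ℤ) :
    boardSum q R N c (M + 1) x - q ^ (M + 1) * boardSum q R N c (M + 1) (x - 1)
      = boardSum q R N c M x := by
  unfold boardSum
  rw [mul_sum, ← sum_sub_distrib]
  refine sum_congr rfl fun w _ => ?_
  rw [← qMultichoose_succ_sub hq M, sub_right_comm x 1]
  ring

lemma boardSum_removeLastRow (hq : 1 < q) {N : ℕ} {c : ℕ → ℕ} {m : ℕ}
    (hm : ∀ i ≤ N, N < c i ↔ m ≤ i) (hmN : m ≤ N + 1) (hc : ∀ i ≤ N, c i ≤ N + 1) (M : ℕ) (x : ℤ) :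
    boardSum q R (N + 1) c M x = ∑ j ∈ range (N + 1),
      q ^ (if j < m then m - 1 - j else N + m - j)
        * boardSum q R N (removeColumn c N j) M (x - if m ≤ j ∧ R ≤ N then 1 else 0) := by
  rw [boardSum, sum_perm_eq_sum_insertPerm_letter (Fin.last N), sum_range]
  refine sum_congr rfl fun j _ => ?_
  rw [boardSum, mul_sum]
  refine sum_congr rfl fun w _ => ?_
  rw [boardStat_insertPerm c j w hm hmN hc, boardHits_insertPerm, zpow_add₀ (by linarith),
    zpow_natCast]
  simp only [hm j (by lia)]
  push_cast
  rw [sub_add_eq_sub_sub_swap]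
  ring

lemma qBracket_mul_boardSum_succ (hq : 1 < q) {N : ℕ} (hNR : N ≤ R) (c : ℕ → ℕ) (M : ℕ) (x : ℤ) :
    qBracket q (M + 1) * boardSum q R N c (M + 1) x
      = qBracket q (x + (M + 1)) * boardSum q R N c M x := by
  unfold boardSum
  rw [mul_sum, mul_sum]
  refine sum_congr rfl fun w _ => ?_
  have h0 : boardHits R c w = 0 := sum_eq_zero fun i _ => if_neg fun h => by lia
  rw [h0, Nat.cast_zero, sub_zero]
  linear_combination q ^ boardStat c w * qBracket_mul_qMultichoose_succ hq M x

lemma sum_range_pow_eq_qBracket (hq : 1 < q) (n : ℕ) :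
    ∑ j ∈ range n, q ^ (n - 1 - j) = qBracket q n := by
  rw [sum_range_reflect (fun j => q ^ j), geom_sum_eq hq.ne', qBracket, zpow_natCast]

lemma sum_removeColumn_labels (q : ℝ) {m N : ℕ} (hmN : m ≤ N + 1) (f : ℕ → ℝ) :
    ∑ j ∈ range (N + 1), q ^ (if j < m then m - 1 - j else N + m - j) * f j
      = ∑ j ∈ range m, q ^ (m - 1 - j) * f j
        + ∑ j ∈ Ico m (N + 1), q ^ (N + 1 - 1 + m - j) * f j := by
  rw [← sum_range_add_sum_Ico _ hmN]
  congr 1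
  · exact sum_congr rfl fun j hj => by rw [if_pos (mem_range.1 hj)]
  · exact sum_congr rfl fun j hj => by rw [if_neg (by have := mem_Ico.1 hj; lia)]; rfl

theorem boardSum_eq_prod (hq : 1 < q) (N : ℕ) {c : ℕ → ℕ} (hc : Monotone c)
    (hcN : ∀ i < N, c i ≤ N) (x : ℕ) :
    boardSum q R N c N x = ∏ i ∈ range N, qBracket q (x + i + 1 - (c i - R : ℕ)) := by
  induction N generalizing c x with
  | zero =>
    have h1 (w : Equiv.Perm (Fin 0)) : q ^ boardStat c w * qMultichoose q 0 (x - boardHits R c w)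
      = 1 := by simp [boardStat, boardHits, qMultichoose]
    simp [boardSum, h1]
  | succ N ih =>
    obtain ⟨m, hmN, hm⟩ := exists_first_full_column hc N
    have hcN' : ∀ i ≤ N, c i ≤ N + 1 := fun i hi => hcN i (by lia)
    let U : ℤ → ℕ → ℝ := fun y i => qBracket q (y + i + 1 - (min (c i) N - R : ℕ))
    have hU : ∀ y i, U y i = q * U (y - 1) i + 1 := fun y i => by
      simp only [U]
      rw [← qBracket_succ hq]
      congr 1
      ring
    have hV : ∀ j ≤ N, ∀ y : ℕ, boardSum q R N (removeColumn c N j) N y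
        = (∏ i ∈ range j, U y i) * ∏ i ∈ Ico (j + 1) (N + 1), U (y - 1) i := fun j hj y => by
      rw [ih (monotone_removeColumn hc N j) (fun i _ => removeColumn_le c N j i),
        prod_removeColumn hj c (fun z k => qBracket q (z + 1 - (k - R : ℕ)))]
    rcases lt_or_ge N R with hNR | hRN
    · rw [prod_range_succ]
      have hK : ∀ j ≤ N, boardSum q R N (removeColumn c N j) N x
          = ∏ i ∈ range N, qBracket q (x + i + 1 - (c i - R : ℕ)) := fun j hj => by
        rw [ih (monotone_removeColumn hc N j) (fun i _ => removeColumn_le c N j i)]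
        refine prod_congr rfl fun i hi => ?_
        have h1 := removeColumn_le c N j i
        have h2 := hcN' i (mem_range.1 hi).le
        rw [Nat.sub_eq_zero_of_le (by lia), Nat.sub_eq_zero_of_le (by lia)]
      have h2 := hcN' N le_rfl
      apply mul_left_cancel₀ (qBracket_natCast_succ_ne_zero hq N)
      rw [boardSum_removeLastRow R hq hm hmN hcN', mul_sum]
      have h3 : ∀ j ∈ range (N + 1), qBracket q (N + 1)
          * (q ^ (if j < m then m - 1 - j else N + m - j)
            * boardSum q R N (removeColumn c N j) (N + 1) (x - if m ≤ j ∧ R ≤ N then 1 else 0))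
          = q ^ (if j < m then m - 1 - j else N + m - j) * (qBracket q (x + (N + 1))
            * ∏ i ∈ range N, qBracket q (x + i + 1 - (c i - R : ℕ))) := fun j hj => by
        rw [if_neg (show ¬ (m ≤ j ∧ R ≤ N) by lia), sub_zero, mul_left_comm,
          qBracket_mul_boardSum_succ R hq hNR.le,
          hK j (by have := mem_range.1 hj; lia)]
      rw [sum_congr rfl h3, sum_removeColumn_labels q hmN, ← sum_mul, ← sum_mul, ← add_mul,
        sum_range_pow_eq_qBracket hq, Nat.sub_eq_zero_of_le (show c N ≤ R by lia)]
      have h4 : ∑ j ∈ Ico m (N + 1), q ^ (N + 1 - 1 + m - j)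
          = q ^ m * qBracket q (N + 1 - m : ℕ) := by
        rw [← sum_range_pow_eq_qBracket hq, mul_sum, sum_Ico_eq_sum_range]
        refine sum_congr rfl fun j hj => ?_
        have := mem_range.1 hj
        rw [← pow_add]
        congr 1
        lia
      have h5 : qBracket q m + q ^ m * qBracket q (N + 1 - m : ℕ) = qBracket q (N + 1) := by
        have h6 : q ^ (N + 1) = q ^ m * q ^ (N + 1 - m) := by rw [← pow_add]; congr 1; lia
        have h7 : q ^ ((N : ℤ) + 1) = q ^ (N + 1) := by exact_mod_cast zpow_natCast q (N + 1)
        rw [qBracket, qBracket, qBracket, h7, zpow_natCast, zpow_natCast, h6]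
        ring
      rw [h4, h5, Nat.cast_zero, sub_zero, add_assoc (x : ℤ)]
      ring
    · have hstep : ∀ y : ℤ, boardSum q R (N + 1) c (N + 1) y
          - q ^ (N + 1) * boardSum q R (N + 1) c (N + 1) (y - 1)
          = ∑ j ∈ range m, q ^ (m - 1 - j) * boardSum q R N (removeColumn c N j) N y
          + ∑ j ∈ Ico m (N + 1), q ^ (N + 1 - 1 + m - j)
            * boardSum q R N (removeColumn c N j) N (y - 1) := fun y => by
        rw [boardSum_succ_sub R hq, boardSum_removeLastRow R hq hm hmN hcN',
          sum_removeColumn_labels q hmN]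
        congr 1
        · refine sum_congr rfl fun j hj => ?_
          rw [if_neg (by have := mem_range.1 hj; lia), sub_zero]
        · refine sum_congr rfl fun j hj => ?_
          rw [if_pos ⟨(mem_Ico.1 hj).1, hRN⟩]
      have hfirst : ∀ y : ℕ, ∑ j ∈ range m, q ^ (m - 1 - j)
          * boardSum q R N (removeColumn c N j) N y
          = (∏ i ∈ range m, U y i - q ^ m * ∏ i ∈ range m, U (y - 1) i)
            * ∏ i ∈ Ico m (N + 1), U (y - 1) i := fun y => by
        rw [← sum_range_pow_mul_prod (hU y) hmN]
        exact sum_congr rfl fun j hj => by rw [hV j (by have := mem_range.1 hj; lia)]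
      have hprod : ∀ y : ℤ,
          ∏ i ∈ range (N + 1), qBracket q (y + i + 1 - (c i - R : ℕ))
            = (∏ i ∈ range m, U y i) * ∏ i ∈ Ico m (N + 1), U (y - 1) i := fun y => by
        rw [← prod_range_mul_prod_Ico _ hmN]
        congr 1
        · refine prod_congr rfl fun i hi => ?_
          have h1 := mem_range.1 hi
          have h2 := hm i (by lia)
          simp only [U]
          rw [min_eq_left (by lia)]
        · refine prod_congr rfl fun i hi => ?_
          have h1 := mem_Ico.1 hi
          have h2 := hm i (by lia)
          have h3 := hcN' i (by lia)
          simp only [U]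
          congr 1
          rw [min_eq_right (by lia)]
          lia
      induction x with
      | zero =>
        have h0 := hstep 0
        rw [boardSum_of_neg R _ _ _ (by lia : (0 : ℤ) - 1 < 0), mul_zero, sub_zero,
          sum_eq_zero (s := Ico m (N + 1)) fun j _ => by
            rw [boardSum_of_neg R _ _ _ (by lia : (0 : ℤ) - 1 < 0), mul_zero], add_zero] at h0
        have h1 := hfirst 0
        have h2 := hprod 0
        have hzero : (∏ i ∈ range m, U (0 - 1) i) * ∏ i ∈ Ico m (N + 1), U (0 - 1) i = 0 := by
          rw [prod_range_mul_prod_Ico _ hmN]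
          obtain ⟨i, hi, hγ⟩ := exists_fixed_of_monotone (γ := fun i => min (c i) N - R)
            (fun a b hab => Nat.sub_le_sub_right (min_le_min_right _ (hc hab)) _)
            (n := N) (by lia)
          refine prod_eq_zero (mem_range.2 (Nat.lt_succ_of_le hi)) ?_
          simp only [U]
          rw [hγ, ← qBracket_zero (q := q)]
          congr 1
          ring
        rw [Nat.cast_zero] at h1 ⊢
        rw [h2, h0, h1]
        linear_combination (-q ^ m) * hzero
      | succ x ihx =>
        have h0 := hstep (x + 1 : ℕ)
        have h1 := hfirst (x + 1)
        have h2 := hprod (x + 1 : ℕ)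
        have h3 := hprod x
        have h4 : ∑ j ∈ Ico m (N + 1), q ^ (N + 1 - 1 + m - j)
            * boardSum q R N (removeColumn c N j) N x
            = q ^ m * (∏ i ∈ range m, U x i) * (∏ i ∈ Ico m (N + 1), U x i
              - q ^ (N + 1 - m) * ∏ i ∈ Ico m (N + 1), U (x - 1) i) := by
          rw [← sum_Ico_pow_mul_prod (hU x) hmN]
          exact sum_congr rfl fun j hj => by rw [hV j (by have := mem_Ico.1 hj; lia)]
        have h5 : ((x + 1 : ℕ) : ℤ) - 1 = x := by push_cast; ring
        have h6 : q ^ (N + 1) = q ^ m * q ^ (N + 1 - m) := by rw [← pow_add]; congr 1; lia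
        rw [h5] at h0 h1 h2
        rw [ihx, h3, h1, h4] at h0
        rw [h2]
        rw [h6] at h0
        linear_combination h0

end BoardSum

lemma card_filter_prod {α β : Type*} [Fintype α] [Fintype β] (P : α × β → Prop)
    [DecidablePred P] :
    (univ.filter P).card = ∑ i, ∑ k, if P (i, k) then 1 else 0 := by
  rw [card_filter, Fintype.sum_prod_type]

section Descents

variable {n : ℕ} (r : ℕ)

/-- Whether position `k` of `σ` is the bottom of an `r`-descent. -/
abbrev IsDescentBottom (σ : Equiv.Perm (Fin n)) (k : Fin n) : Prop :=
  ∃ i : Fin n, (k : ℕ) = i + 1 ∧ (σ k : ℕ) + r ≤ σ i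

/-- The number of inversions of `σ` whose letters differ by less than `r`. -/
def closeInv (σ : Equiv.Perm (Fin n)) : ℕ :=
  ∑ i, ∑ k, if i < k ∧ σ k < σ i ∧ (σ i : ℕ) < σ k + r then 1 else 0

lemma sum_isDescentBottom (σ : Equiv.Perm (Fin n)) (f : ℕ → ℕ) (k : Fin n) :
    (∑ i : Fin n, if pos1 k = pos1 i + 1 ∧ val1 σ k + r ≤ val1 σ i then f (pos1 i) else 0)
      = if IsDescentBottom r σ k then f k else 0 := by
  split_ifs with h
  · obtain ⟨i, h1, h2⟩ := h
    rw [sum_eq_single i]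
    · rw [if_pos (by simp only [pos1, val1]; lia), h1, pos1]
    · intro l _ hl
      exact if_neg fun h => hl (Fin.ext (by simp only [pos1] at h; lia))
    · simp
  · refine sum_eq_zero fun i _ => if_neg fun h3 => h ⟨i, ?_⟩
    simp only [pos1, val1] at h3
    lia

lemma rdes_eq_sum (σ : Equiv.Perm (Fin n)) :
    rdes r σ = ∑ k, if IsDescentBottom r σ k then 1 else 0 := by
  rw [rdes, rdesPairs, card_filter_prod, sum_comm]
  exact sum_congr rfl fun k _ => sum_isDescentBottom r σ (fun _ => 1) k

lemma rmaj_eq_sum (σ : Equiv.Perm (Fin n)) :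
    rmaj r σ = (∑ k : Fin n, if IsDescentBottom r σ k then (k : ℕ) else 0) + closeInv r σ := by
  rw [rmaj, rdesPairs, sum_filter, Fintype.sum_prod_type, sum_comm]
  congr 1
  · exact sum_congr rfl fun k _ => sum_isDescentBottom r σ id k
  · rw [card_filter_prod, closeInv]
    refine sum_congr rfl fun i _ => sum_congr rfl fun k _ => if_congr ?_ rfl rfl
    simp only [val1, Fin.lt_def]
    lia

variable {r} (p : Fin (n + 1)) (σ : Equiv.Perm (Fin n))

lemma not_isDescentBottom_insertPerm_self (hr : 1 ≤ r) :
    ¬ IsDescentBottom r (insertPerm p (Fin.last n) σ) p := by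
  rintro ⟨i, -, h⟩
  rw [insertPerm_self, Fin.val_last] at h
  have := (insertPerm p (Fin.last n) σ i).isLt
  lia

lemma val_insertPerm_last_succAbove (k : Fin n) :
    (insertPerm p (Fin.last n) σ (p.succAbove k) : ℕ) = σ k := by
  rw [insertPerm_succAbove, Fin.succAbove_last, Fin.val_castSucc]

lemma isDescentBottom_insertPerm_succAbove (k : Fin n) :
    IsDescentBottom r (insertPerm p (Fin.last n) σ) (p.succAbove k)
      ↔ if (k : ℕ) = p then (σ k : ℕ) + r ≤ n else IsDescentBottom r σ k := by
  have h0 := val_succAbove p k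
  simp only [IsDescentBottom, val_insertPerm_last_succAbove]
  rw [Fin.exists_iff_succAbove p]
  simp only [insertPerm_self, val_insertPerm_last_succAbove, Fin.val_last]
  split_ifs with hkp
  · refine ⟨?_, fun h => Or.inl (by rw [if_neg (by lia)] at h0; lia)⟩
    rintro (h | ⟨i, -, h⟩)
    · exact h.2
    · lia
  · constructor
    · rintro (h | ⟨i, h1, h2⟩)
      · split_ifs at h0 <;> lia
      · have h3 := val_succAbove p i
        exact ⟨i, by split_ifs at h0 h3 <;> lia, h2⟩
    · rintro ⟨i, h1, h2⟩
      have h3 := val_succAbove p i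
      exact Or.inr ⟨i, by split_ifs at h0 h3 <;> lia, h2⟩

lemma closeInv_insertPerm :
    closeInv r (insertPerm p (Fin.last n) σ)
      = closeInv r σ + ∑ k : Fin n, if (p : ℕ) ≤ k ∧ n < σ k + r then 1 else 0 := by
  have h1 : ∀ k : Fin n, p < p.succAbove k ↔ (p : ℕ) ≤ k := fun k => by
    have := val_succAbove p k
    rw [Fin.lt_def]
    split_ifs at this <;> lia
  have h2 : ∀ k : Fin n, ¬ n < (σ k : ℕ) := fun k => by lia
  simp only [closeInv, Fin.sum_univ_succAbove (n := n) _ p, insertPerm_self,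
    Fin.lt_def (n := n + 1), val_insertPerm_last_succAbove, Fin.val_last, h2]
  simp only [← Fin.lt_def, h1, Fin.succAbove_lt_succAbove_iff, Fin.is_lt, lt_irrefl, true_and,
    false_and, and_false, if_false, zero_add]
  rw [add_comm]

variable (r) in
/-- Whether inserting the largest letter just before place `k` leaves the number of `r`-descents
unchanged. -/
abbrev IsNeutralPlace (k : ℕ) : Prop :=
  ∃ h : k < n, IsDescentBottom r σ ⟨k, h⟩ ∨ n < σ ⟨k, h⟩ + r

lemma isNeutralPlace_val (k : Fin n) :
    IsNeutralPlace r σ k ↔ IsDescentBottom r σ k ∨ n < σ k + r := by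
  simp [IsNeutralPlace]

lemma sum_ite_eq_and_not (S : ℕ → Prop) [DecidablePred S] (a : ℕ) :
    (∑ k : Fin n, if (k : ℕ) = p ∧ ¬ S k then a else 0) = if (p : ℕ) < n ∧ ¬ S p then a else 0 := by
  rw [Fin.sum_univ_eq_sum_range (fun k => if k = (p : ℕ) ∧ ¬ S k then a else 0)]
  simp only [ite_and]
  rw [sum_ite_eq']
  simp

lemma rdes_insertPerm (hr : 1 ≤ r) :
    rdes r (insertPerm p (Fin.last n) σ)
      = rdes r σ + if (p : ℕ) < n ∧ ¬ IsNeutralPlace r σ p then 1 else 0 := by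
  rw [rdes_eq_sum, rdes_eq_sum, Fin.sum_univ_succAbove _ p,
    if_neg (not_isDescentBottom_insertPerm_self p σ hr), zero_add, ← sum_ite_eq_and_not,
    ← sum_add_distrib]
  refine sum_congr rfl fun k _ => ?_
  have h : IsDescentBottom r σ k → (σ k : ℕ) + r ≤ n := fun ⟨i, _, h⟩ => by lia
  simp only [isDescentBottom_insertPerm_succAbove, isNeutralPlace_val]
  split_ifs <;> grind

lemma rmaj_insertPerm (hr : 1 ≤ r) :
    rmaj r (insertPerm p (Fin.last n) σ)
      = rmaj r σ + ((∑ k ∈ range n, if (p : ℕ) ≤ k ∧ IsNeutralPlace r σ k then 1 else 0)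
        + if (p : ℕ) < n ∧ ¬ IsNeutralPlace r σ p then (p : ℕ) + 1 else 0) := by
  rw [rmaj_eq_sum, rmaj_eq_sum, Fin.sum_univ_succAbove _ p,
    if_neg (not_isDescentBottom_insertPerm_self p σ hr), zero_add, ← sum_ite_eq_and_not,
    closeInv_insertPerm,
    ← Fin.sum_univ_eq_sum_range (fun k => if (p : ℕ) ≤ k ∧ IsNeutralPlace r σ k then 1 else 0),
    ← sum_add_distrib, add_left_comm, ← sum_add_distrib, add_right_comm, ← sum_add_distrib,
    add_comm]
  congr 1
  refine sum_congr rfl fun k _ => ?_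
  have h0 := val_succAbove p k
  have h : IsDescentBottom r σ k → (σ k : ℕ) + r ≤ n := fun ⟨i, _, h⟩ => by lia
  simp only [isDescentBottom_insertPerm_succAbove, isNeutralPlace_val]
  split_ifs at * <;> grind

lemma sum_isNeutralPlace (hr : 1 ≤ r) :
    (∑ k ∈ range n, if IsNeutralPlace r σ k then 1 else 0) + 1 = rdes r σ + min r (n + 1) := by
  have h1 : (∑ k : Fin n, if n < σ k + r then 1 else 0) + 1 = min r (n + 1) := by
    rw [Equiv.sum_comp σ (fun v : Fin n => if n < (v : ℕ) + r then 1 else 0),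
      Fin.sum_univ_eq_sum_range (fun v => if n < v + r then 1 else 0), ← card_filter,
      show (range n).filter (fun v => n < v + r) = Ico (n + 1 - r) n by
        ext; simp only [mem_filter, mem_range, mem_Ico]; lia, Nat.card_Ico]
    lia
  rw [← h1, rdes_eq_sum, ← add_assoc, ← sum_add_distrib,
    ← Fin.sum_univ_eq_sum_range (fun k => if IsNeutralPlace r σ k then 1 else 0)]
  congr 1
  refine sum_congr rfl fun k _ => ?_
  have h : IsDescentBottom r σ k → (σ k : ℕ) + r ≤ n := fun ⟨i, _, h⟩ => by lia
  simp only [isNeutralPlace_val]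
  split_ifs <;> grind

theorem sum_rmaj_rdes_eq_prod {q : ℝ} (hq : 1 < q) (hr : 1 ≤ r) (n : ℕ) (x : ℕ) :
    ∑ σ : Equiv.Perm (Fin n), q ^ rmaj r σ * qMultichoose q n (x - rdes r σ)
      = ∏ j ∈ range n, qBracket q (x + min r (j + 1) : ℕ) := by
  induction n with
  | zero =>
    have h1 (w : Equiv.Perm (Fin 0)) : q ^ rmaj r w * qMultichoose q 0 (x - rdes r w) = 1 := by
      simp [rmaj, rdes, rdesPairs, qMultichoose]
    simp [h1]
  | succ n ih =>
    rw [prod_range_succ, ← ih, sum_mul, sum_perm_eq_sum_insertPerm_position (Fin.last n)]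
    refine sum_congr rfl fun σ _ => ?_
    have h1 := sum_insertion_labels hq (IsNeutralPlace r σ)
      (fun e => qMultichoose q (n + 1) (x - rdes r σ - e)) n
    have h2 := sum_isNeutralPlace σ hr
    have h3 := qBracket_mul_qMultichoose_add hq n (rdes r σ + min r (n + 1) : ℕ) (x - rdes r σ)
    rw [← h2] at h3
    rw [sum_range] at h1
    have h4 : (x : ℤ) - rdes r σ + ((∑ k ∈ range n, if IsNeutralPlace r σ k then 1 else 0) + 1 : ℕ)
        = (x + min r (n + 1) : ℕ) := by
      rw [h2]
      push_cast
      ring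
    rw [h4, zpow_natCast] at h3
    rw [mul_assoc, mul_comm (qMultichoose q n _), ← h3]
    simp only [rmaj_insertPerm _ σ hr, rdes_insertPerm _ σ hr, pow_add _ (rmaj r σ), mul_assoc,
      ← mul_sum, Nat.cast_add, ← sub_sub]
    congr 1
    rw [h1]
    push_cast
    rw [sub_zero, sub_right_comm ((n : ℤ) + 1), add_sub_cancel_right, mul_assoc]

end Descents

/-- The Ferrers board of the `h`-level excedance letters. -/
def levelBoard (h j : ℕ) : ℕ := if h ≤ j + 1 then j else 0

lemma monotone_levelBoard (h : ℕ) : Monotone (levelBoard h) := fun a b hab => by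
  unfold levelBoard
  split_ifs <;> lia

section LevelBoard

variable {n : ℕ} (σ : Equiv.Perm (Fin n))

lemma isHit_levelBoard (h : ℕ) (i : Fin n) :
    IsHit (levelBoard h) σ i ↔ pos1 i < val1 σ i ∧ h ≤ val1 σ i := by
  simp only [IsHit, levelBoard, pos1, val1]
  split_ifs <;> lia

lemma invOn_eq_sum (P : Fin n → Prop) [DecidablePred P] :
    invOn σ P = ∑ i, ∑ k, if i < k ∧ P i ∧ P k ∧ val1 σ k < val1 σ i then 1 else 0 :=
  card_filter_prod _

lemma boardStat_levelBoard (h : ℕ) : boardStat (levelBoard h) σ = denLvl h σ := by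
  rw [boardStat, denLvl, invOn_eq_sum, invOn_eq_sum, add_assoc, sum_filter]
  push_cast
  simp only [← sum_add_distrib]
  refine sum_congr rfl fun i _ => congrArg₂ (fun s t : ℤ => s + t) ?_ (sum_congr rfl fun k _ => ?_)
  · rw [if_congr (isHit_levelBoard σ h i) rfl rfl]
    split_ifs with hi
    · rw [levelBoard, if_pos (show h ≤ (σ i : ℕ) + 1 from hi.2), pos1]
      push_cast
      ring
    · rfl
  · have h1 : val1 σ k < val1 σ i ↔ σ k < σ i := by simp only [val1, Fin.lt_def]; lia
    simp only [isHit_levelBoard, h1]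
    split_ifs <;> grind

lemma boardHits_levelBoard {r h : ℕ} (hr : 1 ≤ r) (hhr : h ≤ r + 1) :
    boardHits (r - 1) (levelBoard h) σ = excLvl r σ := by
  rw [boardHits, excLvl, card_filter]
  refine sum_congr rfl fun i _ => if_congr ?_ rfl rfl
  rw [isHit_levelBoard]
  simp only [pos1, val1]
  lia

theorem sum_denLvl_excLvl_eq_prod {q : ℝ} (hq : 1 < q) {r h : ℕ} (hr : 1 ≤ r) (hhr : h ≤ r + 1)
    (n x : ℕ) :
    ∑ σ : Equiv.Perm (Fin n), q ^ denLvl h σ * qMultichoose q n (x - excLvl r σ)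
      = ∏ j ∈ range n, qBracket q (x + min r (j + 1) : ℕ) := by
  have h1 := boardSum_eq_prod (r - 1) hq n (monotone_levelBoard h)
    (fun i hi => by unfold levelBoard; split_ifs <;> lia) x
  simp only [boardSum, boardStat_levelBoard, boardHits_levelBoard _ hr hhr, zpow_natCast] at h1
  rw [h1]
  refine prod_congr rfl fun j _ => congrArg _ ?_
  unfold levelBoard
  split_ifs <;> lia

end LevelBoard

section Equidistribution

variable {α : Type*} [Fintype α]

/-- The numbers of elements with given values of two statistics `u` and `s` are determined by the
expansions of the generating function in `q`-binomial coefficients. -/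
lemma sum_pow_filter_eq {u s u' s' : α → ℕ} {n : ℕ} {q : ℝ} (hq : 1 < q)
    (h : ∀ x : ℕ, ∑ w, q ^ s w * qMultichoose q n (x - u w)
      = ∑ w, q ^ s' w * qMultichoose q n (x - u' w)) (a : ℕ) :
    ∑ w with u w = a, q ^ s w = ∑ w with u' w = a, q ^ s' w := by
  have hexp : ∀ (u s : α → ℕ) (x : ℕ), ∑ w, q ^ s w * qMultichoose q n (x - u w)
      = ∑ k ∈ range x, (∑ w with u w = k, q ^ s w) * qMultichoose q n (x - k)
        + ∑ w with u w = x, q ^ s w := fun u s x => by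
    have h1 : ∑ w with u w = x, q ^ s w
        = (∑ w with u w = x, q ^ s w) * qMultichoose q n (x - x) := by
      rw [sub_self, qMultichoose_zero_right hq, mul_one]
    rw [h1, ← sum_range_succ (fun k : ℕ => (∑ w with u w = k, q ^ s w) * qMultichoose q n (x - k))]
    simp only [sum_filter, sum_mul]
    rw [sum_comm]
    refine sum_congr rfl fun w _ => ?_
    simp only [ite_mul, zero_mul]
    rw [sum_ite_eq]
    split_ifs with hw
    · rfl
    · rw [qMultichoose_of_neg (by have := mt mem_range.2 hw; lia), mul_zero]
  induction a using Nat.strong_induction_on with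
  | _ a ih =>
    have h2 := h a
    rw [hexp, hexp, sum_congr rfl fun k hk => by rw [ih k (mem_range.1 hk)]] at h2
    exact add_left_cancel h2

theorem card_filter_eq_of_sum_eq {u s u' s' : α → ℕ} {n : ℕ}
    (h : ∀ q : ℝ, 1 < q → ∀ x : ℕ, ∑ w, q ^ s w * qMultichoose q n (x - u w)
      = ∑ w, q ^ s' w * qMultichoose q n (x - u' w)) (a b : ℕ) :
    (univ.filter fun w => u w = a ∧ s w = b).card
      = (univ.filter fun w => u' w = a ∧ s' w = b).card := by
  have hpoly : ∑ w with u w = a, (Polynomial.X : Polynomial ℝ) ^ s w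
      = ∑ w with u' w = a, Polynomial.X ^ s' w := by
    refine Polynomial.eq_of_infinite_eval_eq _ _ ((Set.Ioi_infinite (1 : ℝ)).mono fun q hq => ?_)
    simp only [Set.mem_ofPred_eq, Polynomial.eval_finsetSum, Polynomial.eval_pow,
      Polynomial.eval_X]
    exact sum_pow_filter_eq hq (h q hq) a
  have hcoeff : ∀ u s : α → ℕ,
      (∑ w with u w = a, (Polynomial.X : Polynomial ℝ) ^ s w).coeff b
        = (univ.filter fun w => u w = a ∧ s w = b).card := fun u s => by
    simp only [Polynomial.finsetSum_coeff, Polynomial.coeff_X_pow, sum_boole, filter_filter,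
      eq_comm (a := b)]
  exact_mod_cast (hcoeff u s).symm.trans
    ((congrArg (fun f => f.coeff b) hpoly).trans (hcoeff u' s'))

end Equidistribution

/-- Corollary 1.5: for `1 ≤ h ≤ r + 1`, the pair `(exc_r, den_h)` is `r`-Euler–Mahonian. -/
theorem excLvl_denLvl_is_r_euler_mahonian (r h n : ℕ) (hr : 1 ≤ r) (hh : 1 ≤ h)
    (hhr : h ≤ r + 1) (hn : 1 ≤ n) (a b : ℕ) :
    ((univ : Finset (Equiv.Perm (Fin n))).filter fun σ =>
        excLvl r σ = a ∧ denLvl h σ = b).card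
      = ((univ : Finset (Equiv.Perm (Fin n))).filter fun σ =>
          rdes r σ = a ∧ rmaj r σ = b).card :=
  card_filter_eq_of_sum_eq (n := n) (fun q hq x => by
    rw [sum_denLvl_excLvl_eq_prod hq hr hhr, sum_rmaj_rdes_eq_prod hq hr]) a b

end PaperStmt
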